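/- arXiv:1602.07062 — 5 statements merged into one kernel-verified Lean document; each statement's English description precedes it below -/
import Mathlib

section
/- Let κ, b be real numbers with κ ≠ 0. Then ∫₀^b J₀(κt) dt = (1/π) ∫₀^{π/2} (e^{iκb·sin φ} − e^{−iκb·sin φ})/(iκ·sin φ) dφ, where the integrand on the right is understood as its continuous extension (with value 2b at φ = 0). -/
open Real MeasureTheory

/-- Bessel function of the first kind of nonnegative integer order `m`. -/
noncomputable def besselJ (m : ℕ) (x : ℝ) : ℝ :=
  ∑' j : ℕ, ((-1 : ℝ) ^ j / ((j.factorial : ℝ) * ((j + m).factorial : ℝ))) * (x / 2) ^ (2 * j + m)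

/-- The central binomial form of Wallis' product for even powers of sine. -/
theorem integral_sin_pow_even_zero_pi_div_two (n : ℕ) :
    ∫ φ in (0:ℝ)..(π / 2), Real.sin φ ^ (2 * n) =
      π / 2 * (((2 * n).factorial : ℝ) / (4 ^ n * (n.factorial : ℝ) ^ 2)) := by
  have hprod : ∏ i ∈ Finset.range n, (2 * (i : ℝ) + 1) / (2 * i + 2) =
      ((2 * n).factorial : ℝ) / (4 ^ n * (n.factorial : ℝ) ^ 2) := by
    induction n with
    | zero => simp
    | succ k ih =>
      have hk : (k.factorial : ℝ) ≠ 0 := by positivity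
      rw [Finset.prod_range_succ, ih, show 2 * (k + 1) = 2 * k + 1 + 1 by ring]
      simp only [Nat.factorial_succ]
      push_cast
      field_simp
      ring
  have hcos : ∫ φ in (0:ℝ)..(π / 2), Real.sin φ ^ (2 * n) =
      ∫ φ in (0:ℝ)..(π / 2), Real.cos φ ^ (2 * n) := by
    have h := intervalIntegral.integral_comp_sub_left (a := 0) (b := π / 2)
      (fun φ => Real.sin φ ^ (2 * n)) (π / 2)
    simpa [Real.sin_pi_div_two_sub] using h.symm
  rw [hcos, EulerSine.integral_cos_pow_eq, integral_sin_pow_even, hprod]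
  ring

/-- Bessel's integral representation of `J₀`. -/
theorem besselJ_zero_eq_integral (x : ℝ) :
    besselJ 0 x = 2 / π * ∫ φ in (0:ℝ)..(π / 2), Real.cos (x * Real.sin φ) := by
  have hsum : HasSum
      (fun n : ℕ => ∫ φ in (0:ℝ)..(π / 2),
        (-1 : ℝ) ^ n * (x * Real.sin φ) ^ (2 * n) / ((2 * n).factorial : ℝ))
      (∫ φ in (0:ℝ)..(π / 2), Real.cos (x * Real.sin φ)) := by
    refine intervalIntegral.hasSum_integral_of_dominated_convergence
      (fun n _ => x ^ (2 * n) / ((2 * n).factorial : ℝ)) ?_ ?_ ?_ ?_ ?_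
    · exact fun n => Continuous.aestronglyMeasurable (by fun_prop)
    · refine fun n => ae_of_all _ fun φ _ => ?_
      have hsin : (Real.sin φ ^ 2) ^ n ≤ 1 := pow_le_one₀ (sq_nonneg _) (Real.sin_sq_le_one φ)
      have hx : 0 ≤ (x ^ 2) ^ n := by positivity
      simp only [norm_div, norm_mul, norm_pow, norm_neg, norm_one, one_pow, one_mul,
        Real.norm_eq_abs, Nat.abs_cast, pow_mul, sq_abs, mul_pow]
      gcongr
      exact mul_le_of_le_one_right hx hsin
    · exact ae_of_all _ fun _ _ => (Real.hasSum_cosh x).summable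
    · exact intervalIntegrable_const
    · exact ae_of_all _ fun φ _ => Real.hasSum_cos (x * Real.sin φ)
  rw [← (hsum.mul_left (2 / π)).tsum_eq, besselJ]
  refine tsum_congr fun n => ?_
  have hterm : ∀ φ : ℝ, (-1 : ℝ) ^ n * (x * Real.sin φ) ^ (2 * n) / ((2 * n).factorial : ℝ) =
      (-1 : ℝ) ^ n * x ^ (2 * n) / ((2 * n).factorial : ℝ) * Real.sin φ ^ (2 * n) :=
    fun φ => by ring
  have h4 : (2 : ℝ) ^ (2 * n) = 4 ^ n := by rw [pow_mul]; norm_num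
  have hfac : ((2 * n).factorial : ℝ) ≠ 0 := by positivity
  simp only [hterm, intervalIntegral.integral_const_mul, integral_sin_pow_even_zero_pi_div_two,
    add_zero, div_pow, h4]
  field_simp

/-- The primitive of `t ↦ cos (κ t s)` in exponential form, extended continuously to `s = 0`. -/
theorem two_mul_integral_cos_mul (κ b s : ℝ) (hκ : κ ≠ 0) :
    ((2 * ∫ t in (0:ℝ)..b, Real.cos (κ * t * s) : ℝ) : ℂ) =
      if s = 0 then ((2 * b : ℝ) : ℂ)
      else (Complex.exp (Complex.I * κ * b * s) - Complex.exp (-(Complex.I * κ * b * s))) /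
        (Complex.I * κ * s) := by
  split_ifs with hs
  · simp [hs]
  · have hz : (κ * s : ℂ) ≠ 0 := by exact_mod_cast mul_ne_zero hκ hs
    have hcos : ∀ t : ℝ, ((Real.cos (κ * t * s) : ℝ) : ℂ) = Complex.cos ((κ * s : ℂ) * t) :=
      fun t => by push_cast; ring_nf
    rw [Complex.ofReal_mul, ← intervalIntegral.integral_ofReal]
    simp only [hcos]
    rw [integral_cos_mul_complex hz, Complex.sin,
      show (κ * s * b : ℂ) * Complex.I = Complex.I * κ * b * s by ring,
      show -(κ * s * b : ℂ) * Complex.I = -(Complex.I * κ * b * s) by ring]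
    have hκ' : (κ : ℂ) ≠ 0 := left_ne_zero_of_mul hz
    have hs' : (s : ℂ) ≠ 0 := right_ne_zero_of_mul hz
    have hI := Complex.I_ne_zero
    simp only [Complex.ofReal_zero, mul_zero, Complex.sin_zero, zero_div, sub_zero]
    push_cast
    field_simp
    rw [Complex.I_sq]
    ring

theorem stmt_0 (κ b : ℝ) (hκ : κ ≠ 0) :
    ((∫ t in (0:ℝ)..b, besselJ 0 (κ * t)) : ℂ) =
      (1 / (π : ℂ)) *
        ∫ φ in (0:ℝ)..(π / 2),
          (if Real.sin φ = 0 then ((2 * b : ℝ) : ℂ)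
           else (Complex.exp (Complex.I * κ * b * Real.sin φ) -
                  Complex.exp (-(Complex.I * κ * b * Real.sin φ))) /
                (Complex.I * κ * Real.sin φ)) := by
  have hswap : ∫ t in (0:ℝ)..b, ∫ φ in (0:ℝ)..(π / 2), Real.cos (κ * t * Real.sin φ) =
      ∫ φ in (0:ℝ)..(π / 2), ∫ t in (0:ℝ)..b, Real.cos (κ * t * Real.sin φ) := by
    refine intervalIntegral_intervalIntegral_swap ?_
    have hcont : Continuous
        (Function.uncurry fun t φ : ℝ => Real.cos (κ * t * Real.sin φ)) := by
      unfold Function.uncurry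
      fun_prop
    exact (hcont.continuousOn.integrableOn_compact (isCompact_uIcc.prod isCompact_uIcc)).mono_set
      (Set.prod_mono Set.uIoc_subset_uIcc Set.uIoc_subset_uIcc)
  simp only [← two_mul_integral_cos_mul κ b _ hκ]
  rw [intervalIntegral.integral_ofReal, intervalIntegral.integral_ofReal]
  simp only [besselJ_zero_eq_integral, intervalIntegral.integral_const_mul, hswap]
  push_cast
  ring
end

section
/- Let κ > 0 and b > 0. Then ∫₀^b J₀(κt) dt = 1/κ − (2b/π) ∫₀^{∞} p^{−1/2} e^{−p} · Re( e^{iκb} · (κb + ip)^{−1} · (p − 2iκb)^{−1/2} ) dp, where z^{−1/2} denotes the principal branch of the inverse square root on the complex plane slit along the negative real axis. -/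
open Real MeasureTheory

section BesselIntegral

open Set Filter Topology

theorem prod_odd_div_even_eq (n : ℕ) :
    ∏ i ∈ Finset.range n, (2 * (i : ℝ) + 1) / (2 * i + 2) =
      ((2 * n).factorial : ℝ) / (2 ^ n * n.factorial) ^ 2 := by
  induction n with
  | zero => simp
  | succ k ih =>
    rw [Finset.prod_range_succ, ih, show 2 * (k + 1) = 2 * k + 1 + 1 by ring,
      Nat.factorial_succ (2 * k + 1), Nat.factorial_succ (2 * k), Nat.factorial_succ k]
    have : (k.factorial : ℝ) ≠ 0 := by positivity
    push_cast
    field_simp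
    ring

/-- Bessel's integral for order zero. -/
theorem integral_cos_mul_sin_eq_pi_mul_besselJ (x : ℝ) :
    ∫ θ in (0 : ℝ)..π, Real.cos (x * Real.sin θ) = π * besselJ 0 x := by
  have key : HasSum (fun n : ℕ => ∫ θ in (0 : ℝ)..π,
      (-1 : ℝ) ^ n * (x * Real.sin θ) ^ (2 * n) / ((2 * n).factorial : ℝ))
      (∫ θ in (0 : ℝ)..π, Real.cos (x * Real.sin θ)) := by
    refine intervalIntegral.hasSum_integral_of_dominated_convergence
      (fun n _ => |x| ^ (2 * n) / ((2 * n).factorial : ℝ)) ?_ ?_ ?_ ?_ ?_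
    · intro n
      exact (by fun_prop : Continuous fun θ : ℝ =>
        (-1 : ℝ) ^ n * (x * Real.sin θ) ^ (2 * n) / ((2 * n).factorial : ℝ)).aestronglyMeasurable
    · intro n
      refine .of_forall fun θ _ => ?_
      rw [Real.norm_eq_abs, abs_div, abs_mul, abs_pow, abs_neg, abs_one, one_pow, one_mul, abs_pow,
        abs_mul, Nat.abs_cast]
      gcongr
      exact mul_le_of_le_one_right (abs_nonneg x) (Real.abs_sin_le_one θ)
    · refine .of_forall fun θ _ => ?_
      exact (Real.summable_pow_div_factorial |x|).comp_injective
        (mul_right_injective₀ (two_ne_zero' ℕ))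
    · exact intervalIntegrable_const
    · exact .of_forall fun θ _ => Real.hasSum_cos _
  rw [besselJ, ← tsum_mul_left, ← key.tsum_eq]
  refine tsum_congr fun n => ?_
  have h : ∀ θ : ℝ, (-1 : ℝ) ^ n * (x * Real.sin θ) ^ (2 * n) / ((2 * n).factorial : ℝ) =
      ((-1 : ℝ) ^ n * x ^ (2 * n) / ((2 * n).factorial : ℝ)) * Real.sin θ ^ (2 * n) := by
    intro θ; rw [mul_pow]; ring
  simp_rw [h]
  rw [intervalIntegral.integral_const_mul, integral_sin_pow_even, prod_odd_div_even_eq]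
  have h1 : (n.factorial : ℝ) ≠ 0 := by positivity
  have h2 : ((2 * n).factorial : ℝ) ≠ 0 := by positivity
  simp only [add_zero]
  rw [div_pow, pow_mul 2 2 n, mul_pow, ← pow_mul, mul_comm n 2, pow_mul 2 2 n]
  field_simp

theorem integral_cos_mul_sin_half (x : ℝ) :
    ∫ θ in (0 : ℝ)..π / 2, Real.cos (x * Real.sin θ) = π / 2 * besselJ 0 x := by
  have hc : Continuous fun θ : ℝ => Real.cos (x * Real.sin θ) := by fun_prop
  have h1 := intervalIntegral.integral_add_adjacent_intervals
    (hc.intervalIntegrable (μ := volume) 0 (π / 2)) (hc.intervalIntegrable (π / 2) π)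
  have h2 := intervalIntegral.integral_comp_sub_left
    (a := 0) (b := π / 2) (fun θ : ℝ => Real.cos (x * Real.sin θ)) π
  simp only [Real.sin_pi_sub, sub_zero, sub_half] at h2
  rw [integral_cos_mul_sin_eq_pi_mul_besselJ] at h1
  linarith

theorem continuous_besselJ_zero : Continuous (besselJ 0) := by
  have h : besselJ 0 = fun x => π⁻¹ * ∫ θ in (0 : ℝ)..π, Real.cos (x * Real.sin θ) := by
    funext x
    rw [integral_cos_mul_sin_eq_pi_mul_besselJ, inv_mul_cancel_left₀ Real.pi_ne_zero]
  rw [h]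
  exact continuous_const.mul
    (intervalIntegral.continuous_parametric_intervalIntegral_of_continuous' (by fun_prop) _ _)

end BesselIntegral

section StripFunction

open Set Filter Topology

/-- The branch of `1 / √(1 - z²)` that is holomorphic on the half-strip
`0 ≤ Re z < 1`, `0 ≤ Im z`. -/
noncomputable def invSqrtOneSubSq (z : ℂ) : ℂ := (1 - z ^ 2) ^ (-(1 : ℂ) / 2)

theorem one_sub_sq_mem_slitPlane {z : ℂ} (h0 : 0 ≤ z.re) (h1 : z.re ≤ 1)
    (h : z.re < 1 ∨ 0 < z.im) : 1 - z ^ 2 ∈ Complex.slitPlane := by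
  refine Or.inl ?_
  have : (1 - z ^ 2).re = 1 - z.re ^ 2 + z.im ^ 2 := by simp [pow_two]; ring
  rw [this]
  rcases h with h | h <;> nlinarith [sq_nonneg z.im]

theorem differentiableAt_invSqrtOneSubSq {z : ℂ} (hz : 1 - z ^ 2 ∈ Complex.slitPlane) :
    DifferentiableAt ℂ invSqrtOneSubSq z := by
  unfold invSqrtOneSubSq
  exact DifferentiableAt.cpow (by fun_prop) (by fun_prop) hz

theorem norm_invSqrtOneSubSq (z : ℂ) :
    ‖invSqrtOneSubSq z‖ = ‖1 - z ^ 2‖ ^ (-(1 : ℝ) / 2) := by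
  rw [invSqrtOneSubSq, ← Complex.norm_cpow_real]
  norm_num

theorem norm_invSqrtOneSubSq_le {z : ℂ} (h0 : 0 ≤ z.re) (h : 0 < z.im) :
    ‖invSqrtOneSubSq z‖ ≤ z.im ^ (-(1 : ℝ) / 2) := by
  rw [norm_invSqrtOneSubSq]
  refine Real.rpow_le_rpow_of_nonpos h ?_ (by norm_num)
  have h1 : z.im ≤ ‖1 - z‖ := by
    have := Complex.abs_im_le_norm (1 - z)
    simp only [Complex.sub_im, Complex.one_im, zero_sub, abs_neg] at this
    exact (le_abs_self _).trans this
  have h2 : 1 ≤ ‖1 + z‖ := by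
    have := Complex.re_le_norm (1 + z)
    simp only [Complex.add_re, Complex.one_re] at this
    linarith
  rw [show 1 - z ^ 2 = (1 - z) * (1 + z) by ring, norm_mul]
  nlinarith

/-- The integrand `e^{ixz} / √(1 - z²)` of the contour integral. -/
noncomputable def stripFun (x : ℝ) (z : ℂ) : ℂ :=
  Complex.exp (Complex.I * x * z) * invSqrtOneSubSq z

theorem differentiableAt_stripFun (x : ℝ) {z : ℂ} (hz : 1 - z ^ 2 ∈ Complex.slitPlane) :
    DifferentiableAt ℂ (stripFun x) z :=
  DifferentiableAt.mul (by fun_prop) (differentiableAt_invSqrtOneSubSq hz)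

theorem norm_stripFun_le (x : ℝ) {z : ℂ} (h0 : 0 ≤ z.re) (h : 0 < z.im) :
    ‖stripFun x z‖ ≤ z.im ^ (-(1 : ℝ) / 2) * Real.exp (-x * z.im) := by
  rw [stripFun, norm_mul, Complex.norm_exp, mul_comm]
  have : (Complex.I * x * z).re = -x * z.im := by simp
  rw [this]
  gcongr
  exact norm_invSqrtOneSubSq_le h0 h

theorem continuousOn_stripFun_vertical (x : ℝ) {a : ℝ} (h0 : 0 ≤ a) (h1 : a ≤ 1) :
    ContinuousOn (fun y : ℝ => stripFun x (a + y * Complex.I)) (Ioi 0) := by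
  intro y hy
  have hs : 1 - ((a : ℂ) + y * Complex.I) ^ 2 ∈ Complex.slitPlane :=
    one_sub_sq_mem_slitPlane (by simpa using h0) (by simpa using h1) (.inr (by simpa using hy))
  exact ((differentiableAt_stripFun x hs).continuousAt.comp
    (f := fun y : ℝ => (a : ℂ) + y * Complex.I) (by fun_prop)).continuousWithinAt

theorem integrableOn_rpow_mul_exp {x : ℝ} (hx : 0 < x) :
    IntegrableOn (fun y : ℝ => y ^ (-(1 : ℝ) / 2) * Real.exp (-x * y)) (Ioi 0) := by
  simpa using integrableOn_rpow_mul_exp_neg_mul_rpow (s := -(1 : ℝ) / 2) (p := 1) (b := x)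
    (by norm_num) one_pos hx

theorem integrableOn_stripFun_vertical {x : ℝ} (hx : 0 < x) {a : ℝ} (h0 : 0 ≤ a) (h1 : a ≤ 1) :
    IntegrableOn (fun y : ℝ => stripFun x (a + y * Complex.I)) (Ioi 0) := by
  refine (integrableOn_rpow_mul_exp hx).mono'
    ((continuousOn_stripFun_vertical x h0 h1).aestronglyMeasurable measurableSet_Ioi) ?_
  refine (ae_restrict_mem measurableSet_Ioi).mono fun y hy => ?_
  simpa using norm_stripFun_le x (z := a + y * Complex.I) (by simpa using h0) (by simpa using hy)

/-- Cauchy's theorem on the half-strip `0 ≤ Re z ≤ a`, `0 ≤ Im z`, for `a < 1`. -/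
theorem integral_stripFun_horizontal {x : ℝ} (hx : 0 < x) {a : ℝ} (h0 : 0 ≤ a) (h1 : a < 1) :
    (∫ t in (0 : ℝ)..a, stripFun x t) =
      Complex.I * (∫ y in Ioi (0 : ℝ), stripFun x (y * Complex.I)) -
        Complex.I * ∫ y in Ioi (0 : ℝ), stripFun x (a + y * Complex.I) := by
  have rect : ∀ R : ℝ, 0 ≤ R → (∫ t in (0 : ℝ)..a, stripFun x t) -
      (∫ t in (0 : ℝ)..a, stripFun x (t + R * Complex.I)) +
      Complex.I * (∫ y in (0 : ℝ)..R, stripFun x (a + y * Complex.I)) -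
      Complex.I * (∫ y in (0 : ℝ)..R, stripFun x (y * Complex.I)) = 0 := by
    intro R hR
    have := Complex.integral_boundary_rect_eq_zero_of_differentiableOn (stripFun x) 0
      (a + R * Complex.I) ?_
    · simpa using this
    · intro z hz
      simp only [Complex.zero_re, Complex.zero_im, Complex.add_re, Complex.add_im,
        Complex.ofReal_re, Complex.ofReal_im, Complex.mul_re, Complex.mul_im, Complex.I_re,
        Complex.I_im, mul_zero, mul_one, sub_zero, add_zero, zero_add, uIcc_of_le h0,
        uIcc_of_le hR, Complex.mem_reProdIm, mem_Icc] at hz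
      exact (differentiableAt_stripFun x (one_sub_sq_mem_slitPlane hz.1.1 (hz.1.2.trans h1.le)
        (.inl (hz.1.2.trans_lt h1)))).differentiableWithinAt
  have top : Tendsto (fun R : ℝ => ∫ t in (0 : ℝ)..a, stripFun x (t + R * Complex.I)) atTop
      (𝓝 0) := by
    refine squeeze_zero_norm' (a := fun R : ℝ => Real.exp (-x * R)) ?_ ?_
    · filter_upwards [eventually_ge_atTop 1] with R hR
      have hb : ∀ t ∈ uIoc 0 a, ‖stripFun x (t + R * Complex.I)‖ ≤ Real.exp (-x * R) := by
        intro t ht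
        rw [uIoc_of_le h0] at ht
        have := norm_stripFun_le x (z := t + R * Complex.I) (by simpa using ht.1.le)
          (by simpa using zero_lt_one.trans_le hR)
        simp only [Complex.add_im, Complex.ofReal_im, Complex.mul_im, Complex.ofReal_re,
          Complex.I_im, Complex.I_re, mul_one, mul_zero, add_zero, zero_add] at this
        exact this.trans (mul_le_of_le_one_left (Real.exp_pos _).le
          (Real.rpow_le_one_of_one_le_of_nonpos hR (by norm_num)))
      refine (intervalIntegral.norm_integral_le_of_norm_le_const hb).trans ?_
      rw [sub_zero, abs_of_nonneg h0]
      exact mul_le_of_le_one_right (Real.exp_pos _).le h1.le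
    · have : Tendsto (fun R : ℝ => x * R) atTop atTop := tendsto_id.const_mul_atTop hx
      simpa [Function.comp_def] using Real.tendsto_exp_neg_atTop_nhds_zero.comp this
  have right := intervalIntegral_tendsto_integral_Ioi 0
    (integrableOn_stripFun_vertical hx h0 h1.le) tendsto_id
  have left := intervalIntegral_tendsto_integral_Ioi 0
    (integrableOn_stripFun_vertical hx le_rfl zero_le_one) tendsto_id
  simp only [Complex.ofReal_zero, zero_add, id] at left right
  have lim := (((tendsto_const_nhds (x := ∫ t in (0 : ℝ)..a, stripFun x t)).sub top).add
    (right.const_mul Complex.I)).sub (left.const_mul Complex.I)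
  have zero := tendsto_nhds_unique lim
    (tendsto_const_nhds.congr' ((eventually_ge_atTop 0).mono fun R hR => (rect R hR).symm))
  linear_combination zero

theorem integral_exp_sin_eq_integral_stripFun (x : ℝ) {α : ℝ} (h0 : 0 ≤ α) (h1 : α < π / 2) :
    (∫ θ in (0 : ℝ)..α, Complex.exp (Complex.I * x * Real.sin θ)) =
      ∫ t in (0 : ℝ)..Real.sin α, stripFun x t := by
  have hcos : ∀ θ ∈ uIcc 0 α, 0 < Real.cos θ := fun θ hθ => by
    rw [uIcc_of_le h0] at hθ
    exact Real.cos_pos_of_mem_Ioo ⟨by linarith [hθ.1, Real.pi_pos], by linarith [hθ.2]⟩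
  have hsin : ∀ θ ∈ uIcc 0 α, 0 ≤ Real.sin θ := fun θ hθ => by
    rw [uIcc_of_le h0] at hθ
    exact Real.sin_nonneg_of_nonneg_of_le_pi hθ.1 (by linarith [hθ.2])
  have hcont : ContinuousOn (fun t : ℝ => stripFun x t) (Real.sin '' uIcc 0 α) := by
    rintro _ ⟨θ, hθ, rfl⟩
    have hlt : Real.sin θ < 1 := by
      nlinarith [Real.sin_sq_add_cos_sq θ, hcos θ hθ, hsin θ hθ]
    have hs : 1 - ((Real.sin θ : ℝ) : ℂ) ^ 2 ∈ Complex.slitPlane :=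
      one_sub_sq_mem_slitPlane (by simpa only [Complex.ofReal_re] using hsin θ hθ)
        (by simpa only [Complex.ofReal_re] using hlt.le)
        (.inl (by simpa only [Complex.ofReal_re] using hlt))
    exact ((differentiableAt_stripFun x hs).continuousAt.comp
      (f := fun t : ℝ => (t : ℂ)) (by fun_prop)).continuousWithinAt
  have := intervalIntegral.integral_deriv_smul_comp' (a := 0) (b := α) (f := Real.sin)
    (f' := Real.cos) (g := fun t : ℝ => stripFun x t) (fun θ _ => Real.hasDerivAt_sin θ)
    Real.continuous_cos.continuousOn hcont
  rw [Real.sin_zero] at this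
  rw [← this]
  refine intervalIntegral.integral_congr fun θ hθ => ?_
  have hc := hcos θ hθ
  have hsq : (1 : ℂ) - ((Real.sin θ : ℝ) : ℂ) ^ 2 = ((Real.cos θ ^ 2 : ℝ) : ℂ) := by
    rw [Real.cos_sq']; push_cast; ring
  have hinv : invSqrtOneSubSq (Real.sin θ : ℝ) = ((Real.cos θ)⁻¹ : ℝ) := by
    rw [invSqrtOneSubSq, hsq, show (-(1 : ℂ) / 2) = ((-(1 : ℝ) / 2 : ℝ) : ℂ) by push_cast; ring,
      ← Complex.ofReal_cpow (by positivity), ← Real.rpow_natCast, ← Real.rpow_mul hc.le]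
    norm_num [Real.rpow_neg_one]
  have hc' : ((Real.cos θ : ℝ) : ℂ) ≠ 0 := by exact_mod_cast hc.ne'
  simp only [Function.comp, stripFun, hinv, Complex.real_smul]
  rw [Complex.ofReal_inv]
  field_simp

/-- `J₀` as an integral over the ray `1 + i[0, ∞)`, obtained by letting `a → 1` in
`integral_stripFun_horizontal`. -/
theorem pi_div_two_mul_besselJ_eq_im {x : ℝ} (hx : 0 < x) :
    π / 2 * besselJ 0 x = (∫ y in Ioi (0 : ℝ), stripFun x (1 + y * Complex.I)).im := by
  have axis : (∫ y in Ioi (0 : ℝ), stripFun x (y * Complex.I)).im = 0 := by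
    have h : ∀ y : ℝ, stripFun x (y * Complex.I) =
        ((Real.exp (-x * y) * (1 + y ^ 2) ^ (-(1 : ℝ) / 2) : ℝ) : ℂ) := by
      intro y
      rw [stripFun, invSqrtOneSubSq, Complex.ofReal_mul, Complex.ofReal_exp,
        Complex.ofReal_cpow (by positivity)]
      congr 2
      · push_cast
        linear_combination (x * y : ℂ) * Complex.I_sq
      · push_cast
        linear_combination -(y : ℂ) ^ 2 * Complex.I_sq
      · push_cast; ring
    simp_rw [h]
    rw [integral_complex_ofReal, Complex.ofReal_im]
  have partialEq : ∀ α : ℝ, 0 ≤ α → α < π / 2 →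
      ∫ θ in (0 : ℝ)..α, Real.cos (x * Real.sin θ) =
        (∫ y in Ioi (0 : ℝ), stripFun x (Real.sin α + y * Complex.I)).im := by
    intro α h0 h1
    have hs0 : 0 ≤ Real.sin α := Real.sin_nonneg_of_nonneg_of_le_pi h0 (by linarith)
    have hs1 : Real.sin α < 1 := by
      have : 0 < Real.cos α := Real.cos_pos_of_mem_Ioo ⟨by linarith, h1⟩
      nlinarith [Real.sin_sq_add_cos_sq α]
    have h := (integral_exp_sin_eq_integral_stripFun x h0 h1).trans
      (integral_stripFun_horizontal hx hs0 hs1)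
    have hre := congrArg Complex.re h
    have hint : IntervalIntegrable (fun θ : ℝ => Complex.exp (Complex.I * x * Real.sin θ))
        volume 0 α := (by fun_prop : Continuous _).intervalIntegrable _ _
    rw [← Complex.reCLM_apply, ← Complex.reCLM.intervalIntegral_comp_comm hint] at hre
    rw [Complex.sub_re, Complex.I_mul_re, Complex.I_mul_re, axis, neg_zero, zero_sub, neg_neg]
      at hre
    rw [← hre]
    refine intervalIntegral.integral_congr fun θ _ => ?_
    simp only [Complex.reCLM_apply]
    rw [show Complex.I * x * (Real.sin θ : ℝ) = ((x * Real.sin θ : ℝ) : ℂ) * Complex.I by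
      push_cast; ring, Complex.exp_ofReal_mul_I_re]
  have limL : Tendsto (fun α : ℝ => ∫ θ in (0 : ℝ)..α, Real.cos (x * Real.sin θ))
      (𝓝[<] (π / 2)) (𝓝 (π / 2 * besselJ 0 x)) := by
    rw [← integral_cos_mul_sin_half]
    have hc : Continuous fun θ : ℝ => Real.cos (x * Real.sin θ) := by fun_prop
    exact ((intervalIntegral.continuous_primitive
      (fun a b => hc.intervalIntegrable a b) 0).tendsto _).mono_left nhdsWithin_le_nhds
  have hev : ∀ᶠ α : ℝ in 𝓝[<] (π / 2), 0 ≤ α ∧ α < π / 2 := by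
    filter_upwards [Ioo_mem_nhdsLT (show (0 : ℝ) < π / 2 by positivity)] with α hα
    exact ⟨hα.1.le, hα.2⟩
  have limR : Tendsto (fun α : ℝ => ∫ y in Ioi (0 : ℝ), stripFun x (Real.sin α + y * Complex.I))
      (𝓝[<] (π / 2)) (𝓝 (∫ y in Ioi (0 : ℝ), stripFun x (1 + y * Complex.I))) := by
    refine tendsto_integral_filter_of_dominated_convergence
      (fun y : ℝ => y ^ (-(1 : ℝ) / 2) * Real.exp (-x * y)) ?_ ?_ (integrableOn_rpow_mul_exp hx) ?_
    · filter_upwards [hev] with α hα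
      exact (continuousOn_stripFun_vertical x
        (Real.sin_nonneg_of_nonneg_of_le_pi hα.1 (by linarith [hα.2]))
        (Real.sin_le_one α)).aestronglyMeasurable measurableSet_Ioi
    · filter_upwards [hev] with α hα
      refine (ae_restrict_mem measurableSet_Ioi).mono fun y hy => ?_
      have hs0 : 0 ≤ Real.sin α := Real.sin_nonneg_of_nonneg_of_le_pi hα.1 (by linarith [hα.2])
      have := norm_stripFun_le x (z := ((Real.sin α : ℝ) : ℂ) + y * Complex.I)
        (by simpa [-Complex.ofReal_sin] using hs0) (by simpa [-Complex.ofReal_sin] using hy)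
      simpa [-Complex.ofReal_sin] using this
    · refine (ae_restrict_mem measurableSet_Ioi).mono fun y hy => ?_
      have hs : 1 - ((1 : ℂ) + y * Complex.I) ^ 2 ∈ Complex.slitPlane :=
        one_sub_sq_mem_slitPlane (by simp) (by simp) (.inr (by simpa using hy))
      refine (differentiableAt_stripFun x hs).continuousAt.tendsto.comp ?_
      refine Tendsto.mono_left ?_ nhdsWithin_le_nhds
      have : Continuous fun α : ℝ => ((Real.sin α : ℝ) : ℂ) + y * Complex.I := by fun_prop
      simpa [-Complex.ofReal_sin] using this.tendsto (π / 2)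
  refine tendsto_nhds_unique limL (Tendsto.congr' ?_ ((Complex.continuous_im.tendsto _).comp limR))
  filter_upwards [hev] with α hα
  exact (partialEq α hα.1 hα.2).symm

end StripFunction

section RayIntegral

open Set Filter Topology

/-- The integrand of the ray integral whose derivative in `x` is `i` times `stripFun` on the
ray `1 + i[0, ∞)`. -/
noncomputable def rayFun (x u : ℝ) : ℂ :=
  stripFun x (1 + u * Complex.I) * (1 + u * Complex.I)⁻¹

theorem one_add_mul_I_ne_zero (u : ℝ) : (1 : ℂ) + u * Complex.I ≠ 0 := by
  intro h
  simpa using congrArg Complex.re h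

theorem ray_mem_slitPlane {u : ℝ} (hu : 0 < u) :
    1 - ((1 : ℂ) + u * Complex.I) ^ 2 ∈ Complex.slitPlane :=
  one_sub_sq_mem_slitPlane (by simp) (by simp) (.inr (by simpa using hu))

theorem norm_rayFun_le {x u : ℝ} (hx : 0 ≤ x) (hu : 0 < u) :
    ‖rayFun x u‖ ≤ u ^ (-(1 : ℝ) / 2) * (max 1 u)⁻¹ := by
  have h1 := norm_stripFun_le x (z := 1 + u * Complex.I) (by simp) (by simpa using hu)
  simp only [Complex.add_im, Complex.one_im, Complex.mul_im, Complex.ofReal_re, Complex.I_im,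
    Complex.ofReal_im, Complex.I_re, mul_one, mul_zero, add_zero, zero_add] at h1
  have h2 : u ^ (-(1 : ℝ) / 2) * Real.exp (-x * u) ≤ u ^ (-(1 : ℝ) / 2) :=
    mul_le_of_le_one_right (by positivity) (Real.exp_le_one_iff.2 (by nlinarith))
  have h3 : max 1 u ≤ ‖(1 : ℂ) + u * Complex.I‖ := by
    refine max_le ?_ ?_
    · simpa using Complex.re_le_norm ((1 : ℂ) + u * Complex.I)
    · simpa using Complex.im_le_norm ((1 : ℂ) + u * Complex.I)
  rw [rayFun, norm_mul, norm_inv]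
  gcongr
  exact h1.trans h2

theorem integrableOn_rpow_mul_max_inv :
    IntegrableOn (fun u : ℝ => u ^ (-(1 : ℝ) / 2) * (max 1 u)⁻¹) (Ioi 0) := by
  rw [← Ioc_union_Ioi_eq_Ioi (zero_le_one' ℝ)]
  refine IntegrableOn.union ?_ ?_
  · have h := (intervalIntegral.intervalIntegrable_rpow' (a := 0) (b := 1)
      (r := -(1 : ℝ) / 2) (by norm_num)).1
    refine h.congr_fun (fun u hu => ?_) measurableSet_Ioc
    simp only [max_eq_left hu.2, inv_one, mul_one]
  · refine (integrableOn_Ioi_rpow_of_lt (a := -(3 : ℝ) / 2) (by norm_num) one_pos).congr_fun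
      (fun u hu => ?_) measurableSet_Ioi
    have hu' : (0 : ℝ) < u := one_pos.trans hu
    simp only [max_eq_right (mem_Ioi.1 hu).le]
    rw [← Real.rpow_neg_one, ← Real.rpow_add hu']
    norm_num

theorem continuousOn_rayFun (x : ℝ) : ContinuousOn (rayFun x) (Ioi 0) := by
  have h := continuousOn_stripFun_vertical x zero_le_one le_rfl
  simp only [Complex.ofReal_one] at h
  exact h.mul (ContinuousOn.inv₀ (by fun_prop) fun u _ => one_add_mul_I_ne_zero u)

theorem integrableOn_rayFun {x : ℝ} (hx : 0 ≤ x) : IntegrableOn (rayFun x) (Ioi 0) :=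
  integrableOn_rpow_mul_max_inv.mono'
    ((continuousOn_rayFun x).aestronglyMeasurable measurableSet_Ioi)
    ((ae_restrict_mem measurableSet_Ioi).mono fun _ hu => norm_rayFun_le hx hu)

theorem hasDerivAt_rayFun (x u : ℝ) :
    HasDerivAt (fun x => rayFun x u) (Complex.I * stripFun x (1 + u * Complex.I)) x := by
  have h1 : HasDerivAt (fun x : ℝ => Complex.I * x * (1 + u * Complex.I))
      (Complex.I * (1 + u * Complex.I)) x := by
    simpa using ((Complex.ofRealCLM.hasDerivAt (x := x)).const_mul Complex.I).mul_const
      (1 + u * Complex.I)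
  have h2 := (h1.cexp.mul_const (invSqrtOneSubSq (1 + u * Complex.I))).mul_const
    (1 + u * Complex.I)⁻¹
  refine h2.congr_deriv ?_
  have := one_add_mul_I_ne_zero u
  rw [stripFun]
  generalize (1 : ℂ) + u * Complex.I = t at *
  field_simp

theorem hasDerivAt_integral_rayFun {x : ℝ} (hx : 0 < x) :
    HasDerivAt (fun x => ∫ u in Ioi (0 : ℝ), rayFun x u)
      (∫ u in Ioi (0 : ℝ), Complex.I * stripFun x (1 + u * Complex.I)) x := by
  have hmeas := (continuousOn_stripFun_vertical x zero_le_one le_rfl).aestronglyMeasurable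
    (μ := volume) measurableSet_Ioi
  simp only [Complex.ofReal_one] at hmeas
  refine (hasDerivAt_integral_of_dominated_loc_of_deriv_le (Ioi_mem_nhds (half_lt_self hx))
    (bound := fun u : ℝ => u ^ (-(1 : ℝ) / 2) * Real.exp (-(x / 2) * u))
    (F' := fun x u => Complex.I * stripFun x (1 + u * Complex.I)) ?_
    (integrableOn_rayFun hx.le) (hmeas.const_mul Complex.I) ?_
    (integrableOn_rpow_mul_exp (half_pos hx)) ?_).2
  · exact .of_forall fun y => (continuousOn_rayFun y).aestronglyMeasurable measurableSet_Ioi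
  · refine (ae_restrict_mem measurableSet_Ioi).mono fun u hu y hy => ?_
    have hu' : (0 : ℝ) < u := hu
    have hy' : x / 2 < y := hy
    have h := norm_stripFun_le y (z := 1 + u * Complex.I) (by simp) (by simpa using hu)
    simp only [Complex.add_im, Complex.one_im, Complex.mul_im, Complex.ofReal_re, Complex.I_im,
      Complex.ofReal_im, Complex.I_re, mul_one, mul_zero, add_zero, zero_add] at h
    rw [norm_mul, Complex.norm_I, one_mul]
    refine h.trans ?_
    gcongr
  · exact .of_forall fun u y _ => hasDerivAt_rayFun y u

theorem continuousOn_integral_rayFun :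
    ContinuousOn (fun x => ∫ u in Ioi (0 : ℝ), rayFun x u) (Ici 0) := by
  refine continuousOn_of_dominated
    (fun x _ => (continuousOn_rayFun x).aestronglyMeasurable measurableSet_Ioi)
    (fun x hx => (ae_restrict_mem measurableSet_Ioi).mono fun _ hu => norm_rayFun_le hx hu)
    integrableOn_rpow_mul_max_inv
    (.of_forall fun u x _ => (hasDerivAt_rayFun x u).continuousAt.continuousWithinAt)

/-- The square root of `1 - z²` along the ray `z = 1 + iu`. -/
noncomputable def raySqrt (u : ℝ) : ℂ := (1 - (1 + u * Complex.I) ^ 2) ^ (2⁻¹ : ℂ)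

theorem raySqrt_sq (u : ℝ) : raySqrt u ^ 2 = 1 - (1 + u * Complex.I) ^ 2 := by
  rw [raySqrt, Complex.cpow_ofNat_inv_pow]

theorem raySqrt_im_neg {u : ℝ} (hu : 0 < u) : (raySqrt u).im < 0 := by
  have hre : 0 ≤ (raySqrt u).re := by
    rw [raySqrt, Complex.cpow_inv_two_re]
    exact Real.sqrt_nonneg _
  have him := congrArg Complex.im (raySqrt_sq u)
  simp [pow_two] at him
  by_contra! h
  nlinarith

theorem continuousOn_raySqrt : ContinuousOn raySqrt (Ici 0) := by
  intro u hu
  have h : 0 ≤ (1 - ((1 : ℂ) + u * Complex.I) ^ 2).re := by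
    have : (1 - ((1 : ℂ) + u * Complex.I) ^ 2).re = u ^ 2 := by simp [pow_two]
    rw [this]
    positivity
  exact ((Complex.continuousAt_cpow_const_of_re_pos (.inl h) (w := (2⁻¹ : ℂ)) (by norm_num)).comp
    (f := fun u : ℝ => 1 - ((1 : ℂ) + u * Complex.I) ^ 2) (by fun_prop)).continuousWithinAt

theorem hasDerivAt_raySqrt {u : ℝ} (hu : 0 < u) :
    HasDerivAt raySqrt (-Complex.I * (1 + u * Complex.I) * invSqrtOneSubSq (1 + u * Complex.I))
      u := by
  have h1 : HasDerivAt (fun z : ℂ => 1 - (1 + z * Complex.I) ^ 2)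
      (-(2 * (1 + u * Complex.I) * Complex.I)) (u : ℂ) := by
    have := ((((hasDerivAt_id (u : ℂ)).mul_const Complex.I).const_add 1).pow 2).const_sub 1
    simpa using this
  have h2 := (h1.cpow_const (c := (2⁻¹ : ℂ)) (ray_mem_slitPlane hu)).comp_ofReal
  refine h2.congr_deriv ?_
  rw [invSqrtOneSubSq, show (2⁻¹ : ℂ) - 1 = -1 / 2 by norm_num]
  ring

theorem tendsto_raySqrt_cobounded :
    Tendsto raySqrt atTop (Bornology.cobounded ℂ) := by
  rw [← tendsto_norm_atTop_iff_cobounded]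
  refine tendsto_atTop_mono' atTop ?_ tendsto_id
  filter_upwards [eventually_gt_atTop 0] with u hu
  refine le_of_sq_le_sq ?_ (norm_nonneg _)
  rw [← norm_pow, raySqrt_sq]
  have := Complex.re_le_norm (1 - ((1 : ℂ) + u * Complex.I) ^ 2)
  refine le_trans (le_of_eq ?_) this
  simp [pow_two]

/-- The Cayley-type transform of `raySqrt`, with values in the right half-plane. -/
noncomputable def rayCayley (u : ℝ) : ℂ := Complex.I * ((1 + raySqrt u) / (1 - raySqrt u))

theorem one_sub_raySqrt_ne_zero {u : ℝ} (hu : 0 ≤ u) : 1 - raySqrt u ≠ 0 := by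
  rcases hu.eq_or_lt with rfl | hu
  · simp [raySqrt]
  · intro h
    have := congrArg Complex.im h
    simp at this
    exact (raySqrt_im_neg hu).ne this

theorem rayCayley_mem_slitPlane {u : ℝ} (hu : 0 < u) : rayCayley u ∈ Complex.slitPlane := by
  refine Or.inl ?_
  have hn : 0 < Complex.normSq (1 - raySqrt u) :=
    Complex.normSq_pos.2 (one_sub_raySqrt_ne_zero hu.le)
  have : (rayCayley u).re = -2 * (raySqrt u).im / Complex.normSq (1 - raySqrt u) := by
    rw [rayCayley, Complex.I_mul_re, Complex.div_im]
    simp only [Complex.add_im, Complex.one_im, Complex.sub_im, Complex.add_re, Complex.sub_re,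
      Complex.one_re]
    ring
  rw [this]
  exact div_pos (by linarith [raySqrt_im_neg hu]) hn

theorem rayCayley_zero : rayCayley 0 = Complex.I := by simp [rayCayley, raySqrt]

theorem continuousOn_rayCayley : ContinuousOn rayCayley (Ici 0) :=
  continuousOn_const.mul ((continuousOn_const.add continuousOn_raySqrt).div
    (continuousOn_const.sub continuousOn_raySqrt) fun _ hu => one_sub_raySqrt_ne_zero hu)

theorem tendsto_rayCayley : Tendsto rayCayley atTop (𝓝 (-Complex.I)) := by
  have h1 : Tendsto (fun u => 1 - raySqrt u) atTop (Bornology.cobounded ℂ) := by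
    rw [← tendsto_norm_atTop_iff_cobounded]
    have h := tendsto_norm_atTop_iff_cobounded.2 tendsto_raySqrt_cobounded
    refine tendsto_atTop_mono (fun u => ?_) (tendsto_atTop_add_const_right _ (-1) h)
    have := norm_sub_norm_le (raySqrt u) 1
    rw [norm_one, norm_sub_rev] at this
    linarith
  have h2 : Tendsto (fun u => Complex.I * (-1 + 2 * (1 - raySqrt u)⁻¹)) atTop
      (𝓝 (Complex.I * (-1 + 2 * 0))) :=
    (((Filter.tendsto_inv₀_cobounded.comp h1).const_mul 2).const_add (-1)).const_mul Complex.I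
  rw [show Complex.I * (-1 + 2 * 0) = -Complex.I by ring] at h2
  refine h2.congr' ?_
  filter_upwards [eventually_gt_atTop 0] with u hu
  have := one_sub_raySqrt_ne_zero hu.le
  rw [rayCayley]
  field_simp
  ring

theorem hasDerivAt_log_rayCayley {u : ℝ} (hu : 0 < u) :
    HasDerivAt (fun u => Complex.I / 2 * Complex.log (rayCayley u)) (rayFun 0 u) u := by
  have hs := hasDerivAt_raySqrt hu
  have hne := one_sub_raySqrt_ne_zero hu.le
  have ht := one_add_mul_I_ne_zero u
  have hprod : (1 + raySqrt u) * (1 - raySqrt u) = (1 + u * Complex.I) ^ 2 := by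
    linear_combination -raySqrt_sq u
  have hne' : 1 + raySqrt u ≠ 0 := by
    intro h
    rw [h, zero_mul] at hprod
    exact pow_ne_zero 2 ht hprod.symm
  have hq := ((hs.const_add 1).div (hs.const_sub 1) hne).const_mul Complex.I
  have hlog := (HasDerivAt.clog_real (f := rayCayley) hq (rayCayley_mem_slitPlane hu)).const_mul
    (Complex.I / 2)
  refine hlog.congr_deriv ?_
  simp only [rayFun, stripFun, Complex.ofReal_zero, mul_zero, zero_mul, Complex.exp_zero, one_mul]
  rw [rayCayley]
  have hI := Complex.I_ne_zero
  rw [← div_eq_mul_inv, eq_div_iff ht]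
  generalize invSqrtOneSubSq (1 + u * Complex.I) = w at *
  generalize raySqrt u = s at *
  generalize (1 : ℂ) + u * Complex.I = t at *
  field_simp
  linear_combination (-2 * w) * hprod + (-2 * w * t ^ 2) * Complex.I_sq

theorem integral_rayFun_zero : ∫ u in Ioi (0 : ℝ), rayFun 0 u = π / 2 := by
  have hI : Complex.I ∈ Complex.slitPlane := Or.inr (by simp)
  have hnI : -Complex.I ∈ Complex.slitPlane := Or.inr (by simp)
  rw [integral_Ioi_of_hasDerivAt_of_tendsto (m := Complex.I / 2 * Complex.log (-Complex.I))
    (f := fun u => Complex.I / 2 * Complex.log (rayCayley u)) ?_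
    (fun u hu => hasDerivAt_log_rayCayley hu) (integrableOn_rayFun le_rfl)
    ((tendsto_rayCayley.clog hnI).const_mul _)]
  · rw [rayCayley_zero, Complex.log_I, Complex.log_neg_I]
    linear_combination -(π / 2 : ℂ) * Complex.I_sq
  · exact continuousWithinAt_const.mul
      ((continuousOn_rayCayley 0 self_mem_Ici).clog (by rwa [rayCayley_zero]))

/-- The primitive of the Bessel function of order zero as a Laplace-type integral. -/
theorem integral_besselJ_zero {x : ℝ} (hx : 0 < x) :
    ∫ s in (0 : ℝ)..x, besselJ 0 s = 1 - 2 / π * (∫ u in Ioi (0 : ℝ), rayFun x u).re := by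
  have hderiv : ∀ s ∈ Ioo 0 x,
      HasDerivAt (fun s => -(2 / π) * (∫ u in Ioi (0 : ℝ), rayFun s u).re) (besselJ 0 s) s := by
    intro s hs
    have h := (Complex.reCLM.hasFDerivAt.comp_hasDerivAt s
      (hasDerivAt_integral_rayFun hs.1)).const_mul (-(2 / π))
    refine h.congr_deriv ?_
    rw [integral_const_mul, Complex.reCLM_apply, Complex.I_mul_re,
      ← pi_div_two_mul_besselJ_eq_im hs.1]
    field_simp
  rw [intervalIntegral.integral_eq_sub_of_hasDerivAt_of_le hx.le ?_ hderiv
    (continuous_besselJ_zero.intervalIntegrable _ _), integral_rayFun_zero]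
  · have : ((π : ℂ) / 2).re = π / 2 := by
      rw [show (π : ℂ) / 2 = ((π / 2 : ℝ) : ℂ) by push_cast; ring, Complex.ofReal_re]
    rw [this]
    field_simp
    ring
  · exact continuousOn_const.mul (Complex.continuous_re.comp_continuousOn
      (continuousOn_integral_rayFun.mono Icc_subset_Ici_self))

theorem ofReal_mul_cpow {r : ℝ} (hr : 0 < r) {z : ℂ} (hz : z ≠ 0) (c : ℂ) :
    ((r : ℂ) * z) ^ c = (r : ℂ) ^ c * z ^ c := by
  have hr' : (r : ℂ) ≠ 0 := by exact_mod_cast hr.ne'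
  rw [Complex.cpow_def_of_ne_zero (mul_ne_zero hr' hz), Complex.cpow_def_of_ne_zero hr',
    Complex.cpow_def_of_ne_zero hz, Complex.log_ofReal_mul hr hz, Complex.ofReal_log hr.le,
    add_mul, Complex.exp_add]

theorem rescaled_integrand_eq {x u : ℝ} (hx : 0 < x) (hu : 0 < u) :
    (x * u) ^ (-(1 : ℝ) / 2) * Real.exp (-(x * u)) *
      (Complex.exp (Complex.I * x) * ((x : ℂ) + Complex.I * (x * u : ℝ))⁻¹ *
        (((x * u : ℝ) : ℂ) - 2 * Complex.I * x) ^ (-(1 : ℂ) / 2)).re =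
      (x ^ 2)⁻¹ * (rayFun x u).re := by
  rw [← Complex.re_ofReal_mul, ← Complex.re_ofReal_mul]
  congr 1
  have hx' : (x : ℂ) ≠ 0 := by exact_mod_cast hx.ne'
  have hu' : (u : ℂ) ≠ 0 := by exact_mod_cast hu.ne'
  have hz : (u : ℂ) - 2 * Complex.I ≠ 0 := by
    intro h
    simpa using congrArg Complex.im h
  have ht := one_add_mul_I_ne_zero u
  have hc : ((-(1 : ℝ) / 2 : ℝ) : ℂ) = -(1 : ℂ) / 2 := by push_cast; ring
  have hxx : (x : ℂ) ^ (-(1 : ℂ) / 2) * (x : ℂ) ^ (-(1 : ℂ) / 2) = (x : ℂ)⁻¹ := by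
    rw [← Complex.cpow_add _ _ hx', ← Complex.cpow_neg_one]
    norm_num
  have h1 : (((x * u : ℝ) : ℂ) - 2 * Complex.I * x) = x * (u - 2 * Complex.I) := by
    push_cast; ring
  have h2 : 1 - ((1 : ℂ) + u * Complex.I) ^ 2 = u * (u - 2 * Complex.I) := by
    linear_combination -(u : ℂ) ^ 2 * Complex.I_sq
  have h3 : (x : ℂ) + Complex.I * (x * u : ℝ) = x * (1 + u * Complex.I) := by
    push_cast; ring
  have h4 : Complex.exp (Complex.I * x * (1 + u * Complex.I)) =
      Complex.exp (-(x * u)) * Complex.exp (Complex.I * x) := by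
    rw [← Complex.exp_add]
    congr 1
    linear_combination (x * u : ℂ) * Complex.I_sq
  rw [rayFun, stripFun, invSqrtOneSubSq, h1, h2, h3, h4, ofReal_mul_cpow hx hz,
    ofReal_mul_cpow hu hz, Complex.ofReal_mul, Complex.ofReal_exp,
    Complex.ofReal_cpow (by positivity), hc, Complex.ofReal_mul, ofReal_mul_cpow hx hu']
  push_cast
  rw [mul_inv]
  linear_combination ((u : ℂ) ^ (-(1 : ℂ) / 2) * (u - 2 * Complex.I) ^ (-(1 : ℂ) / 2) *
    Complex.exp (-(x * u)) * Complex.exp (Complex.I * x) * (x : ℂ)⁻¹ *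
    (1 + u * Complex.I)⁻¹) * hxx

end RayIntegral

theorem stmt_2 (κ b : ℝ) (hκ : 0 < κ) (hb : 0 < b) :
    ∫ t in (0:ℝ)..b, besselJ 0 (κ * t) =
      1 / κ - (2 * b / π) *
        ∫ p in Set.Ioi (0:ℝ),
          p ^ (-(1:ℝ) / 2) * Real.exp (-p) *
            (Complex.exp (Complex.I * κ * b) * (((κ * b : ℝ) : ℂ) + Complex.I * p)⁻¹ *
              ((p : ℂ) - 2 * Complex.I * κ * b) ^ (-(1:ℂ) / 2)).re := by
  have hx : 0 < κ * b := mul_pos hκ hb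
  set g : ℝ → ℝ := fun p => p ^ (-(1:ℝ) / 2) * Real.exp (-p) *
    (Complex.exp (Complex.I * κ * b) * (((κ * b : ℝ) : ℂ) + Complex.I * p)⁻¹ *
      ((p : ℂ) - 2 * Complex.I * κ * b) ^ (-(1:ℂ) / 2)).re with hg
  have hscale := integral_comp_mul_left_Ioi g 0 hx
  have hcongr : ∫ u in Set.Ioi (0:ℝ), g (κ * b * u) =
      ∫ u in Set.Ioi (0:ℝ), ((κ * b) ^ 2)⁻¹ * (rayFun (κ * b) u).re := by
    refine setIntegral_congr_fun measurableSet_Ioi fun u hu => ?_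
    rw [← rescaled_integrand_eq hx hu, hg]
    simp only [Complex.ofReal_mul, mul_assoc]
  have hre : ∫ u in Set.Ioi (0:ℝ), (rayFun (κ * b) u).re =
      (∫ u in Set.Ioi (0:ℝ), rayFun (κ * b) u).re :=
    Complex.reCLM.integral_comp_comm (integrableOn_rayFun hx.le)
  rw [hcongr, integral_const_mul, hre, mul_zero, smul_eq_mul] at hscale
  have hint : ∫ p in Set.Ioi (0:ℝ), g p =
      (κ * b)⁻¹ * (∫ u in Set.Ioi (0:ℝ), rayFun (κ * b) u).re := by
    rw [eq_comm, inv_mul_eq_iff_eq_mul₀ hx.ne'] at hscale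
    rw [hscale]
    field_simp
  rw [hint, intervalIntegral.integral_comp_mul_left _ hκ.ne', mul_zero,
    integral_besselJ_zero hx, smul_eq_mul]
  field_simp
end

section
/- Let κ > 0, b > 0 and define f(t) = (2b/π) · Re( e^{iκb} · (κb + it)^{−1} · (t − 2iκb)^{−1/2} ) for t ≥ 0, where z^{−1/2} is the principal branch. Then f is infinitely differentiable on [0, ∞), and for every positive integer N and every t ≥ 0, |f^{(2N)}(t)| ≤ (2^{3/2} b / π) · (2N)! · (κb)^{−2N − 3/2}. -/
open Real MeasureTheory

/-- The affine function `t ↦ t - i d` with `d > 0` avoids the slit. -/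
lemma ofReal_sub_mul_I_mem_slitPlane {d : ℝ} (hd : 0 < d) (t : ℝ) :
    (t : ℂ) - d * Complex.I ∈ Complex.slitPlane := by
  right
  simp [hd.ne']

lemma hasDerivAt_ofReal_sub_mul_I_cpow {d : ℝ} (hd : 0 < d) (s : ℂ) (t : ℝ) :
    HasDerivAt (fun t : ℝ => ((t : ℂ) - d * Complex.I) ^ s)
      (s * ((t : ℂ) - d * Complex.I) ^ (s - 1)) t := by
  have h : HasDerivAt (fun t : ℝ => (t : ℂ) - d * Complex.I) 1 t :=
    (Complex.ofRealCLM.hasDerivAt (x := t)).sub_const _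
  have hcomp := (Complex.hasStrictDerivAt_cpow_const (c := s)
    (ofReal_sub_mul_I_mem_slitPlane hd t)).hasDerivAt.comp t h
  rw [mul_one] at hcomp
  exact hcomp

lemma contDiff_ofReal_sub_mul_I_cpow {d : ℝ} (hd : 0 < d) (s : ℂ) (n : ℕ∞) :
    ContDiff ℝ n (fun t : ℝ => ((t : ℂ) - d * Complex.I) ^ s) := by
  have hnat : ∀ (m : ℕ) (s : ℂ), ContDiff ℝ m (fun t : ℝ => ((t : ℂ) - d * Complex.I) ^ s) := by
    intro m
    induction m with
    | zero =>
      intro s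
      exact contDiff_zero.2 (continuous_iff_continuousAt.2 fun t =>
        (hasDerivAt_ofReal_sub_mul_I_cpow hd s t).continuousAt)
    | succ m ih =>
      intro s
      push_cast
      refine contDiff_succ_iff_deriv.2
        ⟨fun t => (hasDerivAt_ofReal_sub_mul_I_cpow hd s t).differentiableAt, by simp, ?_⟩
      rw [funext fun t => (hasDerivAt_ofReal_sub_mul_I_cpow hd s t).deriv]
      exact contDiff_const.mul (ih _)
  exact (contDiff_infty.2 fun m => hnat m s).of_le (by exact_mod_cast le_top)

lemma iteratedDeriv_ofReal_sub_mul_I_cpow {d : ℝ} (hd : 0 < d) (s : ℂ) (n : ℕ) :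
    iteratedDeriv n (fun t : ℝ => ((t : ℂ) - d * Complex.I) ^ s) =
      fun t : ℝ => (∏ j ∈ Finset.range n, (s - j)) * ((t : ℂ) - d * Complex.I) ^ (s - n) := by
  induction n with
  | zero => simp
  | succ n ih =>
    rw [iteratedDeriv_succ, ih]
    funext t
    rw [((hasDerivAt_ofReal_sub_mul_I_cpow hd (s - n) t).const_mul _).deriv,
      Finset.prod_range_succ, ← mul_assoc]
    congr 2
    push_cast
    ring

lemma norm_prod_range_sub_le_factorial {s : ℝ} (hs : -1 ≤ s) (hs0 : s ≤ 0) (n : ℕ) :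
    ‖∏ j ∈ Finset.range n, ((s : ℂ) - j)‖ ≤ n.factorial := by
  rw [← Finset.prod_range_add_one_eq_factorial, norm_prod]
  push_cast
  refine Finset.prod_le_prod (fun _ _ => norm_nonneg _) fun j _ => ?_
  have hj : (0 : ℝ) ≤ j := j.cast_nonneg
  rw [show (s : ℂ) - j = ((s - j : ℝ) : ℂ) by push_cast; rfl, Complex.norm_real,
    Real.norm_eq_abs, abs_le]
  constructor <;> linarith

lemma norm_iteratedFDeriv_ofReal_sub_mul_I_cpow_le {d s : ℝ} (hd : 0 < d) (hs : -1 ≤ s)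
    (hs0 : s ≤ 0) (n : ℕ) (t : ℝ) :
    ‖iteratedFDeriv ℝ n (fun t : ℝ => ((t : ℂ) - d * Complex.I) ^ (s : ℂ)) t‖ ≤
      n.factorial * d ^ (s - n) := by
  have hz : d ≤ ‖(t : ℂ) - d * Complex.I‖ := by
    simpa [abs_of_pos hd] using Complex.abs_im_le_norm ((t : ℂ) - d * Complex.I)
  rw [norm_iteratedFDeriv_eq_norm_iteratedDeriv, iteratedDeriv_ofReal_sub_mul_I_cpow hd, norm_mul,
    show (s : ℂ) - n = ((s - n : ℝ) : ℂ) by push_cast; rfl,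
    Complex.norm_cpow_real]
  have hn : (0 : ℝ) ≤ n := n.cast_nonneg
  exact mul_le_mul (norm_prod_range_sub_le_factorial hs hs0 n)
    (Real.rpow_le_rpow_of_nonpos hd hz (by linarith)) (by positivity) (by positivity)

lemma sum_choose_mul_factorial_mul_rpow_le {c : ℝ} (hc : 0 < c) (n : ℕ) :
    ∑ k ∈ Finset.range (n + 1), (n.choose k : ℝ) * (k.factorial * (2 * c) ^ (-(1 / 2) - k : ℝ)) *
      ((n - k).factorial * c ^ (-1 - (n - k : ℕ) : ℝ)) ≤
      2 ^ (1 / 2 : ℝ) * n.factorial * c ^ (-n - 3 / 2 : ℝ) := by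
  have hterm : ∀ k ∈ Finset.range (n + 1),
      (n.choose k : ℝ) * (k.factorial * (2 * c) ^ (-(1 / 2) - k : ℝ)) *
      ((n - k).factorial * c ^ (-1 - (n - k : ℕ) : ℝ)) =
      2 ^ (-(1 / 2) : ℝ) * n.factorial * c ^ (-n - 3 / 2 : ℝ) * (1 / 2) ^ k := by
    intro k hk
    have hkn : k ≤ n := Nat.lt_succ_iff.1 (Finset.mem_range.1 hk)
    have h1 : (n.choose k : ℝ) * k.factorial * (n - k).factorial = n.factorial := by
      exact_mod_cast Nat.choose_mul_factorial_mul_factorial hkn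
    have h2 : c ^ (-n - 3 / 2 : ℝ) = c ^ (-(1 / 2) - k : ℝ) * c ^ (-1 - (n - k : ℕ) : ℝ) := by
      rw [← Real.rpow_add hc, Nat.cast_sub hkn]
      congr 1
      ring
    have h3 : (2 : ℝ) ^ (-(1 / 2) - k : ℝ) = 2 ^ (-(1 / 2) : ℝ) * (1 / 2) ^ k := by
      rw [Real.rpow_sub two_pos, Real.rpow_natCast, one_div_pow]
      ring
    rw [Real.mul_rpow two_pos.le hc.le, h2, h3, ← h1]
    ring
  rw [Finset.sum_congr rfl hterm, ← Finset.mul_sum]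
  have hgeom : ∑ k ∈ Finset.range (n + 1), (1 / 2 : ℝ) ^ k ≤ 2 := sum_geometric_two_le _
  have h4 : (2 : ℝ) ^ (1 / 2 : ℝ) = 2 ^ (-(1 / 2) : ℝ) * 2 := by
    rw [← Real.rpow_add_one two_ne_zero]
    norm_num
  calc _ ≤ 2 ^ (-(1 / 2) : ℝ) * n.factorial * c ^ (-n - 3 / 2 : ℝ) * 2 := by gcongr
    _ = _ := by rw [h4]; ring

theorem stmt_3 (κ b : ℝ) (hκ : 0 < κ) (hb : 0 < b)
    (f : ℝ → ℝ)
    (hf : ∀ t : ℝ, f t = (2 * b / π) *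
      (Complex.exp (Complex.I * κ * b) * (((κ * b : ℝ) : ℂ) + Complex.I * t)⁻¹ *
        ((t : ℂ) - 2 * Complex.I * κ * b) ^ (-(1:ℂ) / 2)).re) :
    ContDiffOn ℝ (⊤ : ℕ∞) f (Set.Ici (0:ℝ)) ∧
      ∀ N : ℕ, 0 < N → ∀ t : ℝ, 0 ≤ t →
        |iteratedDeriv (2 * N) f t| ≤
          (2 ^ ((3:ℝ) / 2) * b / π) * ((2 * N).factorial : ℝ) *
            (κ * b) ^ (-(2 * (N : ℝ)) - 3 / 2) := by
  have hc : 0 < κ * b := mul_pos hκ hb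
  set c := κ * b with hc_def
  have h2c : 0 < 2 * c := by positivity
  let u : ℝ → ℂ := fun t => ((t : ℂ) - (2 * c : ℝ) * Complex.I) ^ ((-(1 / 2) : ℝ) : ℂ)
  let v : ℝ → ℂ := fun t => ((t : ℂ) - c * Complex.I) ^ ((-1 : ℝ) : ℂ)
  let C : ℂ := (2 * b / π : ℝ) * (Complex.exp ((c : ℝ) * Complex.I) * -Complex.I)
  let L : ℂ →L[ℝ] ℝ := Complex.reCLM.comp (ContinuousLinearMap.mul ℝ ℂ C)
  have hC : ‖C‖ = 2 * b / π := by
    have hpos : 0 < 2 * b / π := by positivity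
    simp only [C, norm_mul, Complex.norm_exp_ofReal_mul_I, norm_neg, Complex.norm_I,
      Complex.norm_real, Real.norm_eq_abs, abs_of_pos hpos, mul_one]
  have hL : ‖L‖ ≤ 2 * b / π := by
    refine (ContinuousLinearMap.opNorm_comp_le _ _).trans ?_
    rw [Complex.reCLM_norm, one_mul, ← hC]
    exact ContinuousLinearMap.opNorm_mul_apply_le ℝ ℂ C
  have hu (n : ℕ∞) : ContDiff ℝ n u := contDiff_ofReal_sub_mul_I_cpow h2c _ n
  have hv (n : ℕ∞) : ContDiff ℝ n v := contDiff_ofReal_sub_mul_I_cpow hc _ n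
  have hfL : f = L ∘ fun t => u t * v t := by
    funext t
    have hinv : ((c : ℂ) + Complex.I * t)⁻¹ = -Complex.I * v t := by
      have h : (c : ℂ) + Complex.I * t = Complex.I * ((t : ℂ) - c * Complex.I) := by
        linear_combination (c : ℂ) * Complex.I_mul_I
      simp only [v]
      rw [h, mul_inv, Complex.inv_I, Complex.ofReal_neg, Complex.ofReal_one, Complex.cpow_neg_one]
    have hroot : ((t : ℂ) - 2 * Complex.I * κ * b) ^ (-(1 : ℂ) / 2) = u t := by
      simp only [u, hc_def]
      congr 1
      · push_cast; ring
      · push_cast; ring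
    have hexp : Complex.I * κ * b = (c : ℂ) * Complex.I := by
      rw [hc_def]; push_cast; ring
    rw [hf t, hinv, hroot, hexp, ← Complex.re_ofReal_mul]
    simp only [L, C, Function.comp_apply, ContinuousLinearMap.comp_apply,
      ContinuousLinearMap.mul_apply', Complex.reCLM_apply]
    congr 1
    ring
  refine ⟨?_, fun N _ t _ => ?_⟩
  · rw [hfL]
    exact (L.contDiff.comp ((hu _).mul (hv _))).contDiffOn
  · set n := 2 * N with hn
    have huv : ContDiff ℝ n (fun t => u t * v t) := by exact_mod_cast (hu n).mul (hv n)
    have hprod : ‖iteratedFDeriv ℝ n (fun t => u t * v t) t‖ ≤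
        2 ^ (1 / 2 : ℝ) * n.factorial * c ^ (-n - 3 / 2 : ℝ) := by
      refine (norm_iteratedFDeriv_mul_le (n := n) (N := n) (by exact_mod_cast hu n)
        (by exact_mod_cast hv n) t le_rfl).trans
        (le_trans (Finset.sum_le_sum fun k _ => ?_) (sum_choose_mul_factorial_mul_rpow_le hc n))
      gcongr
      · exact norm_iteratedFDeriv_ofReal_sub_mul_I_cpow_le h2c (by norm_num) (by norm_num) k t
      · exact norm_iteratedFDeriv_ofReal_sub_mul_I_cpow_le hc le_rfl (by norm_num) (n - k) t
    rw [← Real.norm_eq_abs, ← norm_iteratedFDeriv_eq_norm_iteratedDeriv, hfL,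
      L.iteratedFDeriv_comp_left huv.contDiffAt le_rfl]
    have h2 : (2 : ℝ) ^ (3 / 2 : ℝ) = 2 ^ (1 / 2 : ℝ) * 2 := by
      rw [← Real.rpow_add_one two_ne_zero]
      norm_num
    calc _ ≤ ‖L‖ * ‖iteratedFDeriv ℝ n (fun t => u t * v t) t‖ :=
          ContinuousLinearMap.norm_compContinuousMultilinearMap_le _ _
      _ ≤ 2 * b / π * (2 ^ (1 / 2 : ℝ) * n.factorial * c ^ (-n - 3 / 2 : ℝ)) := by gcongr
      _ = _ := by
          rw [h2, hn]
          push_cast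
          ring
end

section
/- Let n, m be nonnegative integers, let κ be a nonzero real number and b a real number. Then ∫₀^b t^n J_m(κt) dt = b^{n+1} J_m(κb)/(n + m + 1) + (κ/(n + m + 1)) ∫₀^b t^{n+1} J_{m+1}(κt) dt. -/
open Real MeasureTheory

theorem summable_norm_besselJ_term (m : ℕ) (x : ℝ) :
    Summable fun j : ℕ =>
      ‖((-1 : ℝ) ^ j / ((j.factorial : ℝ) * ((j + m).factorial : ℝ))) * (x / 2) ^ (2 * j + m)‖ := by
  refine Summable.of_nonneg_of_le (fun _ => norm_nonneg _) (fun j => ?_)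
    ((Real.summable_pow_div_factorial (|x / 2| ^ 2)).mul_right (|x / 2| ^ m))
  have hj : (0 : ℝ) < j.factorial := by positivity
  have hjm : (1 : ℝ) ≤ (j + m).factorial := by exact_mod_cast Nat.factorial_pos (j + m)
  have hle : (j.factorial : ℝ) ≤ j.factorial * (j + m).factorial :=
    le_mul_of_one_le_right hj.le hjm
  calc _ = (1 / ((j.factorial : ℝ) * (j + m).factorial)) * |x / 2| ^ (2 * j + m) := by
        rw [norm_mul, norm_div, norm_pow, norm_pow, norm_mul, Real.norm_natCast,
          Real.norm_natCast, norm_neg, norm_one, one_pow, Real.norm_eq_abs]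
    _ ≤ (1 / (j.factorial : ℝ)) * |x / 2| ^ (2 * j + m) := by gcongr
    _ = _ := by rw [pow_add, pow_mul]; ring

theorem hasSum_besselJ (m : ℕ) (x : ℝ) :
    HasSum (fun j : ℕ =>
      ((-1 : ℝ) ^ j / ((j.factorial : ℝ) * ((j + m).factorial : ℝ))) * (x / 2) ^ (2 * j + m))
      (besselJ m x) :=
  (summable_norm_besselJ_term m x).of_norm.hasSum

/-- Termwise integration of the power series of `t ^ n * besselJ m (κ * t)`. -/
theorem hasSum_integral_pow_mul_besselJ (n m : ℕ) (κ b : ℝ) :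
    HasSum (fun j : ℕ =>
      ((-1 : ℝ) ^ j / ((j.factorial : ℝ) * ((j + m).factorial : ℝ))) * (κ / 2) ^ (2 * j + m) *
        (b ^ (n + (2 * j + m) + 1) / ((n : ℝ) + (2 * j + m) + 1)))
      (∫ t in (0:ℝ)..b, t ^ n * besselJ m (κ * t)) := by
  have key := intervalIntegral.hasSum_integral_of_dominated_convergence
    (μ := volume) (a := 0) (b := b)
    (F := fun (j : ℕ) (t : ℝ) => t ^ n *
      (((-1 : ℝ) ^ j / ((j.factorial : ℝ) * ((j + m).factorial : ℝ))) *
        (κ * t / 2) ^ (2 * j + m)))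
    (f := fun t => t ^ n * besselJ m (κ * t))
    (fun j _ => |b| ^ n *
      ‖((-1 : ℝ) ^ j / ((j.factorial : ℝ) * ((j + m).factorial : ℝ))) *
        (κ * b / 2) ^ (2 * j + m)‖)
    (fun j => (by fun_prop : Continuous _).aestronglyMeasurable)
    (fun j => ae_of_all _ fun t ht => ?_)
    (ae_of_all _ fun _ _ => (summable_norm_besselJ_term m (κ * b)).mul_left _)
    intervalIntegrable_const
    (ae_of_all _ fun t _ => (hasSum_besselJ m (κ * t)).mul_left _)
  · refine (congrArg (HasSum · _) (funext fun j => ?_)).mpr key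
    have hpow : ∀ t : ℝ, t ^ n *
        (((-1 : ℝ) ^ j / ((j.factorial : ℝ) * ((j + m).factorial : ℝ))) *
          (κ * t / 2) ^ (2 * j + m)) =
        ((-1 : ℝ) ^ j / ((j.factorial : ℝ) * ((j + m).factorial : ℝ))) *
          (κ / 2) ^ (2 * j + m) * t ^ (n + (2 * j + m)) := fun t => by
      rw [mul_div_right_comm, mul_pow, pow_add t n]; ring
    simp_rw [hpow]
    rw [intervalIntegral.integral_const_mul, integral_pow, zero_pow (Nat.succ_ne_zero _), sub_zero]
    push_cast
    rfl
  · have htb : |t| ≤ |b| := by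
      simpa using Set.abs_sub_left_of_mem_uIcc (Set.uIoc_subset_uIcc ht)
    simp only [norm_mul, norm_pow, norm_div, Real.norm_eq_abs]
    gcongr

theorem stmt_5 (n m : ℕ) (κ b : ℝ) (hκ : κ ≠ 0) :
    ∫ t in (0:ℝ)..b, t ^ n * besselJ m (κ * t) =
      b ^ (n + 1) * besselJ m (κ * b) / ((n : ℝ) + m + 1) +
        (κ / ((n : ℝ) + m + 1)) * ∫ t in (0:ℝ)..b, t ^ (n + 1) * besselJ (m + 1) (κ * t) := by
  have hD : (n : ℝ) + m + 1 ≠ 0 := by positivity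
  have hdiff := (hasSum_integral_pow_mul_besselJ n m κ b).sub
    (((hasSum_besselJ m (κ * b)).mul_left (b ^ (n + 1))).div_const ((n : ℝ) + m + 1))
  have hright := (hasSum_integral_pow_mul_besselJ (n + 1) (m + 1) κ b).mul_left
    (κ / ((n : ℝ) + m + 1))
  rw [← hasSum_nat_add_iff' 1] at hdiff
  have hshift := hdiff.unique ((congrArg (HasSum · _) (funext fun j => by
    rw [show j + 1 + m = j + (m + 1) by ring, Nat.factorial_succ j, mul_div_right_comm κ b 2,
      mul_pow]
    push_cast
    field_simp
    ring)).mpr hright)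
  rw [Finset.sum_range_one, mul_div_right_comm κ b 2, mul_pow] at hshift
  rw [← hshift]
  simp only [Nat.cast_zero, mul_zero, zero_add]
  field_simp
  ring
end

section
/- Let m, s be nonnegative integers, let κ be a nonzero real number and b a real number. Define c_0 = 1 and, for 1 ≤ j ≤ s, c_j = Π_{k=0}^{j−1} ( −4(s−k)(m+s−k)/κ² ). Then ∫₀^b t^{m+1+2s} J_m(κt) dt = (1/κ) b^{m+1} J_{m+1}(κb) · Σ_{j=0}^{s} c_{s−j} b^{2j} + (1/κ²) b^{m} J_m(κb) · Σ_{j=1}^{s} c_{s−j} · 2j · b^{2j}. -/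
open Real MeasureTheory

/-- The entire function `∑ (-1)^j y^j / (j! (j+m)!)`, related to the Bessel function by
`J_m(x) = (x/2)^m * besselAux m ((x/2)^2)`. -/
noncomputable def besselAux (m : ℕ) (y : ℝ) : ℝ :=
  ∑' j : ℕ, ((-1 : ℝ) ^ j / ((j.factorial : ℝ) * ((j + m).factorial : ℝ))) * y ^ j

theorem besselJ_eq_besselAux (m : ℕ) (x : ℝ) :
    besselJ m x = (x / 2) ^ m * besselAux m ((x / 2) ^ 2) := by
  unfold besselJ besselAux
  rw [← tsum_mul_left]
  refine tsum_congr fun j => ?_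
  rw [pow_add, pow_mul]
  ring

theorem abs_besselAux_coeff_le (m j : ℕ) :
    |(-1 : ℝ) ^ j / ((j.factorial : ℝ) * ((j + m).factorial : ℝ))| ≤ 1 / (j.factorial : ℝ) := by
  rw [abs_div, abs_pow, abs_neg, abs_one, one_pow, abs_of_pos (by positivity)]
  have h : (1 : ℝ) ≤ ((j + m).factorial : ℝ) := by exact_mod_cast Nat.factorial_pos _
  have hj : (0 : ℝ) < (j.factorial : ℝ) := by positivity
  exact one_div_le_one_div_of_le hj (le_mul_of_one_le_right hj.le h)

theorem summable_besselAux (m : ℕ) (y : ℝ) :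
    Summable fun j : ℕ =>
      ((-1 : ℝ) ^ j / ((j.factorial : ℝ) * ((j + m).factorial : ℝ))) * y ^ j := by
  refine Summable.of_norm_bounded (Real.summable_pow_div_factorial |y|) fun j => ?_
  rw [Real.norm_eq_abs, abs_mul, abs_pow]
  calc _ ≤ 1 / (j.factorial : ℝ) * |y| ^ j := by
        gcongr
        exact abs_besselAux_coeff_le m j
    _ = _ := by ring

theorem besselAux_coeff_succ (m j : ℕ) :
    (-1 : ℝ) ^ (j + 1) / (((j + 1).factorial : ℝ) * ((j + 1 + m).factorial : ℝ)) * ((j : ℝ) + 1) =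
      -((-1 : ℝ) ^ j / ((j.factorial : ℝ) * ((j + (m + 1)).factorial : ℝ))) := by
  rw [show j + 1 + m = j + (m + 1) by ring, Nat.factorial_succ j]
  push_cast
  field_simp
  ring

theorem hasDerivAt_besselAux (m : ℕ) (y : ℝ) :
    HasDerivAt (besselAux m) (-besselAux (m + 1) y) y := by
  set a : ℕ → ℝ := fun j => (-1 : ℝ) ^ j / ((j.factorial : ℝ) * ((j + m).factorial : ℝ)) with ha
  have hbound : Summable fun j : ℕ => (j : ℝ) * (|y| + 1) ^ (j - 1) / (j.factorial : ℝ) := by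
    rw [← summable_nat_add_iff 1]
    refine (Real.summable_pow_div_factorial (|y| + 1)).congr fun j => ?_
    rw [Nat.factorial_succ]
    push_cast
    field_simp
  have hderiv := hasDerivAt_tsum_of_isPreconnected (g := fun j z => a j * z ^ j)
    (g' := fun j z => a j * (j * z ^ (j - 1))) (t := Metric.ball 0 (|y| + 1)) (y₀ := y) (y := y)
    hbound Metric.isOpen_ball (convex_ball _ _).isPreconnected
    (fun j z _ => (hasDerivAt_pow j z).const_mul (a j))
    (fun j z hz => by
      have hz' : |z| ≤ |y| + 1 := by simpa using (mem_ball_zero_iff.mp hz).le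
      rw [Real.norm_eq_abs, abs_mul, abs_mul, abs_pow, Nat.abs_cast]
      calc _ ≤ 1 / (j.factorial : ℝ) * (j * (|y| + 1) ^ (j - 1)) := by
            gcongr
            exact abs_besselAux_coeff_le m j
        _ = _ := by ring)
    (by simp) (summable_besselAux m y) (by simp)
  refine HasDerivAt.congr_deriv (f := besselAux m) hderiv ?_
  have hshift : ∀ j : ℕ, a (j + 1) * (((j + 1 : ℕ) : ℝ) * y ^ (j + 1 - 1)) =
      -((-1 : ℝ) ^ j / ((j.factorial : ℝ) * ((j + (m + 1)).factorial : ℝ)) * y ^ j) := fun j => by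
    rw [← neg_mul, ← besselAux_coeff_succ m j]
    push_cast
    simp only [ha]
    ring
  rw [((summable_nat_add_iff 1).mp ((summable_besselAux (m + 1) y).neg.congr
    fun j => (hshift j).symm)).tsum_eq_zero_add]
  simp only [hshift, tsum_neg]
  simp [besselAux]

theorem besselAux_recurrence (m : ℕ) (y : ℝ) :
    ((m : ℝ) + 1) * besselAux (m + 1) y - y * besselAux (m + 2) y = besselAux m y := by
  have hs := (summable_besselAux m y).sub ((summable_besselAux (m + 1) y).mul_left ((m : ℝ) + 1))
  have hterm : ∀ j : ℕ, (-1 : ℝ) ^ (j + 1) / (((j + 1).factorial : ℝ) * ((j + 1 + m).factorial : ℝ))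
        * y ^ (j + 1) - ((m : ℝ) + 1) * ((-1 : ℝ) ^ (j + 1) / (((j + 1).factorial : ℝ) *
          ((j + 1 + (m + 1)).factorial : ℝ)) * y ^ (j + 1)) =
      -y * ((-1 : ℝ) ^ j / ((j.factorial : ℝ) * ((j + (m + 2)).factorial : ℝ)) * y ^ j) := fun j => by
    rw [show j + 1 + (m + 1) = (j + 1 + m) + 1 by ring, show j + (m + 2) = (j + 1 + m) + 1 by ring,
      Nat.factorial_succ j, Nat.factorial_succ (j + 1 + m)]
    push_cast
    field_simp
    ring
  have hsum : besselAux m y - ((m : ℝ) + 1) * besselAux (m + 1) y = -y * besselAux (m + 2) y := by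
    unfold besselAux
    rw [← tsum_mul_left, ← (summable_besselAux m y).tsum_sub
      ((summable_besselAux (m + 1) y).mul_left ((m : ℝ) + 1)), hs.tsum_eq_zero_add]
    simp only [hterm, tsum_mul_left]
    have : ((m : ℝ) + 1) * (1 / ((m + 1).factorial : ℝ)) = 1 / (m.factorial : ℝ) := by
      rw [Nat.factorial_succ]
      push_cast
      field_simp
    simpa [sub_eq_zero] using this.symm
  linarith

theorem besselJ_recurrence (m : ℕ) (x : ℝ) :
    2 * ((m : ℝ) + 1) * besselJ (m + 1) x = x * (besselJ m x + besselJ (m + 2) x) := by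
  simp only [besselJ_eq_besselAux, ← besselAux_recurrence m]
  ring

theorem exists_hasDerivAt_besselJ (m : ℕ) (x : ℝ) :
    ∃ d, HasDerivAt (besselJ m) d x ∧ x * d = m * besselJ m x - x * besselJ (m + 1) x := by
  have hhalf : HasDerivAt (fun x : ℝ => x / 2) (1 / 2) x := (hasDerivAt_id x).div_const 2
  have h := (hhalf.pow m).mul ((hasDerivAt_besselAux m ((x / 2) ^ 2)).comp x (hhalf.pow 2))
  refine ⟨_, h.congr_of_eventuallyEq (.of_forall fun z => besselJ_eq_besselAux m z), ?_⟩
  simp only [besselJ_eq_besselAux, Function.comp, Pi.pow_apply]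
  cases m with
  | zero => simp; left; ring
  | succ n => simp; ring

theorem continuous_besselJ (m : ℕ) : Continuous (besselJ m) :=
  continuous_iff_continuousAt.mpr fun x =>
    (exists_hasDerivAt_besselJ m x).choose_spec.1.continuousAt

theorem hasDerivAt_pow_mul_besselJ_succ (m n : ℕ) (κ t : ℝ) :
    HasDerivAt (fun t => t ^ (m + 1 + n) * besselJ (m + 1) (κ * t))
      (κ * t ^ (m + 1 + n) * besselJ m (κ * t) + n * t ^ (m + n) * besselJ (m + 1) (κ * t)) t := by
  obtain ⟨d, hd, hd'⟩ := exists_hasDerivAt_besselJ (m + 1) (κ * t)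
  have hlin : HasDerivAt (fun t : ℝ => κ * t) κ t := by
    simpa using (hasDerivAt_id t).const_mul κ
  refine ((hasDerivAt_pow (m + 1 + n) t).mul (hd.comp t hlin)).congr_deriv ?_
  have hrec := besselJ_recurrence m (κ * t)
  rw [show m + 1 + n - 1 = m + n by omega, show m + 1 + n = (m + n) + 1 by ring]
  simp only [Function.comp]
  push_cast at hd' ⊢
  linear_combination t ^ (m + n) * hd' + t ^ (m + n) * hrec

theorem hasDerivAt_pow_mul_besselJ (m n : ℕ) (κ t : ℝ) :
    HasDerivAt (fun t => t ^ (m + (n + 1)) * besselJ m (κ * t))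
      ((2 * m + n + 1) * t ^ (m + n) * besselJ m (κ * t)
        - κ * t ^ (m + n + 1) * besselJ (m + 1) (κ * t)) t := by
  obtain ⟨d, hd, hd'⟩ := exists_hasDerivAt_besselJ m (κ * t)
  have hlin : HasDerivAt (fun t : ℝ => κ * t) κ t := by
    simpa using (hasDerivAt_id t).const_mul κ
  refine ((hasDerivAt_pow (m + (n + 1)) t).mul (hd.comp t hlin)).congr_deriv ?_
  rw [show m + (n + 1) - 1 = m + n by omega, show m + (n + 1) = (m + n) + 1 by ring]
  simp only [Function.comp]
  push_cast
  linear_combination t ^ (m + n) * hd'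

/-- The coefficients `c_j` of the antiderivative of `t ^ (m + 1 + 2 * s) * J_m(κ t)`. -/
noncomputable def besselCoeff (m : ℕ) (κ : ℝ) (s j : ℕ) : ℝ :=
  ∏ k ∈ Finset.range j, (-(4 * ((s : ℝ) - k) * ((m : ℝ) + s - k)) / κ ^ 2)

theorem besselCoeff_succ_succ (m : ℕ) (κ : ℝ) (s j : ℕ) :
    besselCoeff m κ (s + 1) (j + 1) =
      -(4 * ((s : ℝ) + 1) * ((m : ℝ) + s + 1)) / κ ^ 2 * besselCoeff m κ s j := by
  unfold besselCoeff
  rw [Finset.prod_range_succ', mul_comm]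
  congr 1
  · push_cast
    ring
  · refine Finset.prod_congr rfl fun k _ => ?_
    push_cast
    ring

theorem sum_besselCoeff_succ (m : ℕ) (κ : ℝ) (s : ℕ) (f : ℕ → ℝ) :
    ∑ j ∈ Finset.range (s + 2), besselCoeff m κ (s + 1) (s + 1 - j) * f j =
      -(4 * ((s : ℝ) + 1) * ((m : ℝ) + s + 1)) / κ ^ 2 *
        (∑ j ∈ Finset.range (s + 1), besselCoeff m κ s (s - j) * f j) + f (s + 1) := by
  rw [Finset.sum_range_succ, Finset.mul_sum]
  congr 1
  · refine Finset.sum_congr rfl fun j hj => ?_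
    rw [Nat.succ_sub (Nat.lt_succ_iff.mp (Finset.mem_range.mp hj)), Nat.succ_eq_add_one,
      besselCoeff_succ_succ]
    ring
  · simp [besselCoeff]

theorem hasDerivAt_besselJ_antideriv (m s : ℕ) {κ : ℝ} (hκ : κ ≠ 0) (t : ℝ) :
    HasDerivAt (fun b => (1 / κ) * b ^ (m + 1) * besselJ (m + 1) (κ * b) *
          (∑ j ∈ Finset.range (s + 1), besselCoeff m κ s (s - j) * b ^ (2 * j)) +
        (1 / κ ^ 2) * b ^ m * besselJ m (κ * b) *
          (∑ j ∈ Finset.range (s + 1), besselCoeff m κ s (s - j) * (2 * (j : ℝ) * b ^ (2 * j))))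
      (t ^ (m + 1 + 2 * s) * besselJ m (κ * t)) t := by
  induction s with
  | zero =>
    refine (((hasDerivAt_pow_mul_besselJ_succ m 0 κ t).const_mul (1 / κ)).congr_of_eventuallyEq
      (.of_forall fun b => ?_)).congr_deriv ?_
    · simp [besselCoeff]
      ring
    · simp
      field_simp
  | succ s ih =>
    have h₁ := (hasDerivAt_pow_mul_besselJ_succ m (2 * s + 2) κ t).const_mul (1 / κ)
    have h₂ := (hasDerivAt_pow_mul_besselJ m (2 * s + 1) κ t).const_mul ((2 * s + 2) / κ ^ 2)
    refine (((ih.const_mul (-(4 * ((s : ℝ) + 1) * ((m : ℝ) + s + 1)) / κ ^ 2)).add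
      (h₁.add h₂)).congr_of_eventuallyEq (.of_forall fun b => ?_)).congr_deriv ?_
    · simp only [Pi.add_apply]
      rw [sum_besselCoeff_succ, sum_besselCoeff_succ m κ s fun j => 2 * (j : ℝ) * b ^ (2 * j)]
      push_cast
      ring
    · push_cast
      field_simp
      ring

theorem stmt_10 (m s : ℕ) (κ b : ℝ) (hκ : κ ≠ 0) (c : ℕ → ℝ)
    (hc : ∀ j : ℕ, c j =
      ∏ k ∈ Finset.range j, (-(4 * ((s : ℝ) - k) * ((m : ℝ) + s - k)) / κ ^ 2)) :
    ∫ t in (0:ℝ)..b, t ^ (m + 1 + 2 * s) * besselJ m (κ * t) =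
      (1 / κ) * b ^ (m + 1) * besselJ (m + 1) (κ * b) *
          (∑ j ∈ Finset.range (s + 1), c (s - j) * b ^ (2 * j)) +
        (1 / κ ^ 2) * b ^ m * besselJ m (κ * b) *
          (∑ j ∈ Finset.Icc 1 s, c (s - j) * (2 * (j : ℝ)) * b ^ (2 * j)) := by
  obtain rfl : c = besselCoeff m κ s := funext hc
  have hcont : Continuous fun t : ℝ => t ^ (m + 1 + 2 * s) * besselJ m (κ * t) :=
    (continuous_pow _).mul ((continuous_besselJ m).comp (continuous_const.mul continuous_id))
  rw [intervalIntegral.integral_eq_sub_of_hasDerivAt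
    (fun t _ => hasDerivAt_besselJ_antideriv m s hκ t) (hcont.intervalIntegrable 0 b)]
  have hIcc : ∑ j ∈ Finset.Icc 1 s, besselCoeff m κ s (s - j) * (2 * (j : ℝ)) * b ^ (2 * j) =
      ∑ j ∈ Finset.range (s + 1), besselCoeff m κ s (s - j) * (2 * (j : ℝ) * b ^ (2 * j)) := by
    rw [Finset.range_eq_Ico, Finset.sum_eq_sum_Ico_succ_bot (Nat.succ_pos s)]
    simp [← Finset.Ico_add_one_right_eq_Icc, mul_assoc]
  have hzero : ∑ j ∈ Finset.range (s + 1),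
      besselCoeff m κ s (s - j) * (2 * (j : ℝ) * (0 : ℝ) ^ (2 * j)) = 0 :=
    Finset.sum_eq_zero fun j _ => by cases j <;> simp
  rw [hIcc, hzero]
  simp
end
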